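/- Let Y be a regular topological space and let X be a Souslin-F set in a regular completely Baire space Z, such that X (with the subspace topology) is a perfectly paracompact space satisfying the first axiom of countability. Then a mapping f : X → Y is Δ⁰₂-measurable if and only if it is piecewise continuous. -/

import Mathlib

open Set Topology

/-- A set is Fσ if it is a countable union of closed sets. -/
def IsFsigma {X : Type*} [TopologicalSpace X] (s : Set X) : Prop :=
  ∃ C : ℕ → Set X, (∀ n, IsClosed (C n)) ∧ s = ⋃ n, C n

/-- A map is piecewise continuous if its domain is covered by countably many
closed sets on each of which the map is continuous. -/
def PiecewiseContinuous {X Y : Type*} [TopologicalSpace X] [TopologicalSpace Y]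
    (f : X → Y) : Prop :=
  ∃ C : ℕ → Set X, (∀ n, IsClosed (C n)) ∧ (⋃ n, C n) = Set.univ ∧
    ∀ n, ContinuousOn f (C n)

/-- A map is Δ⁰₂-measurable if preimages of open sets are both Fσ and Gδ. -/
def Delta02Measurable {X Y : Type*} [TopologicalSpace X] [TopologicalSpace Y]
    (f : X → Y) : Prop :=
  ∀ U : Set Y, IsOpen U → IsFsigma (f ⁻¹' U) ∧ IsGδ (f ⁻¹' U)

/-- A map is Σ⁰₂-measurable if preimages of open sets are Fσ. -/
def Sigma02Measurable {X Y : Type*} [TopologicalSpace X] [TopologicalSpace Y]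
    (f : X → Y) : Prop :=
  ∀ U : Set Y, IsOpen U → IsFsigma (f ⁻¹' U)

/-- X ⊆ Z is Souslin-F in Z: the result of the A-operation applied to a system
of closed subsets of Z, where `(List.range n).map α` encodes α|n. -/
def SouslinF {Z : Type*} [TopologicalSpace Z] (X : Set Z) : Prop :=
  ∃ F : List ℕ → Set Z, (∀ s, IsClosed (F s)) ∧
    X = ⋃ α : ℕ → ℕ, ⋂ n : ℕ, F ((List.range n).map α)

/-- A space is completely Baire if every closed subspace is a Baire space. -/
def CompletelyBaire (Z : Type*) [TopologicalSpace Z] : Prop :=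
  ∀ s : Set Z, IsClosed s → BaireSpace s

/-- Membership in the σ-ideal I_f: A is contained in an Fσ set F such that
the restriction f|F is piecewise continuous. -/
def MemIf {X Y : Type*} [TopologicalSpace X] [TopologicalSpace Y]
    (f : X → Y) (A : Set X) : Prop :=
  ∃ F : Set X, IsFsigma F ∧ A ⊆ F ∧ PiecewiseContinuous (F.restrict f)

/-- A^f = f⁻¹(Y \ cl(A)). -/
def Af {X Y : Type*} [TopologicalSpace Y] (f : X → Y) (A : Set Y) : Set X :=
  f ⁻¹' (closure A)ᶜ

/-- The pair (x, X′) is f-irreducible outside A: for every open neighborhood V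
of x, A^f ∩ X′ ∩ V ∉ I_f. -/
def IrredOutside {X Y : Type*} [TopologicalSpace X] [TopologicalSpace Y]
    (f : X → Y) (x : X) (X' : Set X) (A : Set Y) : Prop :=
  ∀ V : Set X, IsOpen V → x ∈ V → ¬ MemIf f (Af f A ∩ X' ∩ V)

theorem Af_anti {X Y : Type*} [TopologicalSpace Y] (f : X → Y) {A B : Set Y} (h : A ⊆ B) : Af f B ⊆ Af f A :=
  preimage_mono (compl_subset_compl.2 (closure_mono h))

theorem Af_union {X Y : Type*} [TopologicalSpace Y] (f : X → Y) (A B : Set Y) : Af f (A ∪ B) = Af f A ∩ Af f B := by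
  simp only [Af, closure_union, compl_union, preimage_inter]

theorem Af_union_Af_of_disjoint {X Y : Type*} [TopologicalSpace Y] (f : X → Y) {A B : Set Y}
    (h : Disjoint (closure A) (closure B)) : Af f A ∪ Af f B = univ := by
  rw [Af, Af, ← preimage_union, ← compl_inter, h.inter_eq, compl_empty, preimage_univ]

section ContinuityIdeal

variable {X Y : Type*} [TopologicalSpace X] [TopologicalSpace Y]

/-- The σ-ideal of sets covered by countably many closed sets on each of which `f` is
continuous. -/
def PiecewiseSmall (f : X → Y) (A : Set X) : Prop :=
  ∃ C : ℕ → Set X, (∀ n, IsClosed (C n)) ∧ A ⊆ (⋃ n, C n) ∧ ∀ n, ContinuousOn f (C n)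

theorem PiecewiseSmall.mono {f : X → Y} {A B : Set X} (hB : PiecewiseSmall f B) (h : A ⊆ B) :
    PiecewiseSmall f A := by
  obtain ⟨C, hC, hBC, hf⟩ := hB
  exact ⟨C, hC, h.trans hBC, hf⟩

theorem piecewiseContinuous_of_piecewiseSmall_univ {f : X → Y}
    (h : PiecewiseSmall f univ) : PiecewiseContinuous f := by
  obtain ⟨C, hC, hcover, hf⟩ := h
  exact ⟨C, hC, univ_subset_iff.1 hcover, hf⟩

theorem piecewiseSmall_empty (f : X → Y) : PiecewiseSmall f ∅ :=
  ⟨fun _ => ∅, fun _ => isClosed_empty, empty_subset _, fun _ => continuousOn_empty f⟩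

theorem piecewiseSmall_of_continuousOn_closure {f : X → Y} {A : Set X}
    (h : ContinuousOn f (closure A)) : PiecewiseSmall f A :=
  ⟨fun _ => closure A, fun _ => isClosed_closure,
    subset_closure.trans (subset_iUnion (fun _ : ℕ => closure A) 0), fun _ => h⟩

theorem piecewiseSmall_iUnion {f : X → Y} {A : ℕ → Set X} (h : ∀ n, PiecewiseSmall f (A n)) :
    PiecewiseSmall f (⋃ n, A n) := by
  choose C hC hA hf using h
  refine ⟨fun m => C m.unpair.1 m.unpair.2, fun m => hC _ _, ?_, fun m => hf _ _⟩
  refine iUnion_subset fun n x hx => ?_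
  obtain ⟨k, hk⟩ := mem_iUnion.1 (hA n hx)
  exact mem_iUnion.2 ⟨Nat.pair n k, by simpa using hk⟩

theorem PiecewiseSmall.union {f : X → Y} {A B : Set X} (hA : PiecewiseSmall f A)
    (hB : PiecewiseSmall f B) : PiecewiseSmall f (A ∪ B) := by
  refine (piecewiseSmall_iUnion (f := f) (A := fun n => if n = 0 then A else B) ?_).mono ?_
  · intro n
    split_ifs
    exacts [hA, hB]
  · rintro x (hx | hx)
    · exact mem_iUnion.2 ⟨0, by simpa using hx⟩
    · exact mem_iUnion.2 ⟨1, by simpa using hx⟩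

theorem exists_not_piecewiseSmall_inter {f : X → Y} {A : Set X} {D : ℕ → Set X}
    (hA : ¬ PiecewiseSmall f A) (hD : A ⊆ ⋃ n, D n) : ∃ n, ¬ PiecewiseSmall f (A ∩ D n) := by
  by_contra! h
  refine hA ((piecewiseSmall_iUnion h).mono fun x hx => ?_)
  obtain ⟨n, hn⟩ := mem_iUnion.1 (hD hx)
  exact mem_iUnion.2 ⟨n, hx, hn⟩

theorem isFsigma_of_isOpen (hGdelta : ∀ s : Set X, IsClosed s → IsGδ s) {U : Set X}
    (hU : IsOpen U) : IsFsigma U := by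
  obtain ⟨O, hO, hUO⟩ := (hGdelta _ hU.isClosed_compl).eq_iInter_nat
  refine ⟨fun n => (O n)ᶜ, fun n => (hO n).isClosed_compl, ?_⟩
  rw [← compl_iInter, ← hUO, compl_compl]

/-- In a perfectly paracompact space, membership in the ideal is a local property. -/
theorem piecewiseSmall_inter_sUnion [ParacompactSpace X]
    (hGdelta : ∀ s : Set X, IsClosed s → IsGδ s) {f : X → Y} {A : Set X} {𝒱 : Set (Set X)}
    (hopen : ∀ V ∈ 𝒱, IsOpen V) (hsmall : ∀ V ∈ 𝒱, PiecewiseSmall f (A ∩ V)) :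
    PiecewiseSmall f (A ∩ ⋃₀ 𝒱) := by
  obtain ⟨C, hC, hCeq⟩ := isFsigma_of_isOpen hGdelta (isOpen_sUnion hopen)
  rw [hCeq, inter_iUnion]
  refine piecewiseSmall_iUnion fun n => ?_
  have hcover : C n ⊆ ⋃ V : 𝒱, (V : Set X) := by
    rw [← sUnion_eq_iUnion, hCeq]
    exact subset_iUnion C n
  obtain ⟨v, -, hv_cover, hv_fin, hv_sub⟩ :=
    precise_refinement_set (hC n) (fun V : 𝒱 => (V : Set X)) (fun V => hopen V V.2) hcover
  choose E hE hAE hfE using fun V : 𝒱 => hsmall V V.2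
  have hfin : ∀ m, LocallyFinite fun V : 𝒱 => closure (v V) ∩ E V m := fun m =>
    hv_fin.closure.subset fun V => inter_subset_left
  have hclosed : ∀ m V, IsClosed (closure (v V) ∩ E V m) := fun m V =>
    isClosed_closure.inter (hE V m)
  refine ⟨fun m => ⋃ V : 𝒱, closure (v V) ∩ E V m,
    fun m => (hfin m).isClosed_iUnion (hclosed m), ?_, fun m =>
    (hfin m).continuousOn_iUnion (hclosed m) fun V => (hfE V m).mono inter_subset_right⟩
  rintro x ⟨hxA, hxC⟩
  obtain ⟨V, hV⟩ := mem_iUnion.1 (hv_cover hxC)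
  obtain ⟨m, hm⟩ := mem_iUnion.1 (hAE V ⟨hxA, hv_sub V hV⟩)
  exact mem_iUnion.2 ⟨m, mem_iUnion.2 ⟨V, subset_closure hV, hm⟩⟩

theorem exists_subset_everywhere_not_piecewiseSmall [ParacompactSpace X]
    (hGdelta : ∀ s : Set X, IsClosed s → IsGδ s) {f : X → Y} {A : Set X}
    (hA : ¬ PiecewiseSmall f A) :
    ∃ B ⊆ A, ¬ PiecewiseSmall f B ∧
      ∀ V, IsOpen V → (B ∩ V).Nonempty → ¬ PiecewiseSmall f (B ∩ V) := by
  set 𝒱 : Set (Set X) := {V | IsOpen V ∧ PiecewiseSmall f (A ∩ V)}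
  have hloc : PiecewiseSmall f (A ∩ ⋃₀ 𝒱) :=
    piecewiseSmall_inter_sUnion hGdelta (fun V hV => hV.1) fun V hV => hV.2
  refine ⟨A \ ⋃₀ 𝒱, sdiff_subset, fun h => hA ?_, fun V hV hne h => ?_⟩
  · refine (h.union hloc).mono fun x hx => ?_
    by_cases hx' : x ∈ ⋃₀ 𝒱
    exacts [Or.inr ⟨hx, hx'⟩, Or.inl ⟨hx, hx'⟩]
  · obtain ⟨x, ⟨-, hx⟩, hxV⟩ := hne
    refine hx ⟨V, ⟨hV, (h.union hloc).mono fun y hy => ?_⟩, hxV⟩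
    by_cases hy' : y ∈ ⋃₀ 𝒱
    exacts [Or.inr ⟨hy.1, hy'⟩, Or.inl ⟨⟨hy.1, hy'⟩, hy.2⟩]

/-- Every trace of `S` on a neighbourhood of `x` stays outside the ideal after removing
the preimage of the closure of `A`. -/
def IrreducibleOff (f : X → Y) (x : X) (S : Set X) (A : Set Y) : Prop :=
  ∀ V : Set X, IsOpen V → x ∈ V → ¬ PiecewiseSmall f (S ∩ V ∩ Af f A)

theorem IrreducibleOff.mono {f : X → Y} {x : X} {S T : Set X} {A B : Set Y}
    (h : IrreducibleOff f x S A) (hST : S ⊆ T) (hBA : B ⊆ A) : IrreducibleOff f x T B :=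
  fun V hV hx hT => h V hV hx
    (hT.mono (inter_subset_inter (inter_subset_inter_left V hST) (Af_anti f hBA)))

theorem IrreducibleOff.mem_closure {f : X → Y} {x : X} {S : Set X} {A : Set Y}
    (h : IrreducibleOff f x S A) : x ∈ closure S := by
  rw [mem_closure_iff]
  intro V hV hx
  by_contra hne
  rw [not_nonempty_iff_eq_empty, inter_comm] at hne
  refine h V hV hx ?_
  rw [hne, empty_inter]
  exact piecewiseSmall_empty f

/-- Of two sets with disjoint closures, at most one destroys irreducibility. -/
theorem IrreducibleOff.union_or_union {f : X → Y} {x : X} {S : Set X} {A U₁ U₂ : Set Y}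
    (h : IrreducibleOff f x S A) (hU : Disjoint (closure U₁) (closure U₂)) :
    IrreducibleOff f x S (A ∪ U₁) ∨ IrreducibleOff f x S (A ∪ U₂) := by
  by_contra! hneg
  obtain ⟨h₁, h₂⟩ := hneg
  simp only [IrreducibleOff, not_forall, not_not] at h₁ h₂
  obtain ⟨V₁, hV₁, hx₁, hs₁⟩ := h₁
  obtain ⟨V₂, hV₂, hx₂, hs₂⟩ := h₂
  refine h (V₁ ∩ V₂) (hV₁.inter hV₂) ⟨hx₁, hx₂⟩ ((hs₁.union hs₂).mono ?_)
  rintro y ⟨⟨hyS, hy₁, hy₂⟩, hyA⟩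
  have hy : y ∈ Af f U₁ ∪ Af f U₂ := by
    rw [Af_union_Af_of_disjoint f hU]
    exact mem_univ y
  rw [Af_union, Af_union]
  rcases hy with hy | hy
  exacts [Or.inl ⟨⟨hyS, hy₁⟩, hyA, hy⟩, Or.inr ⟨⟨hyS, hy₂⟩, hyA, hy⟩]

theorem exists_isOpen_closure_subset [RegularSpace X] {x : X} {O : Set X} (hO : IsOpen O)
    (hx : x ∈ O) : ∃ V, IsOpen V ∧ x ∈ V ∧ closure V ⊆ O := by
  obtain ⟨t, ht, htc, hts⟩ := exists_mem_nhds_isClosed_subset (hO.mem_nhds hx)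
  exact ⟨interior t, isOpen_interior, mem_interior_iff_mem_nhds.2 ht,
    (closure_minimal interior_subset htc).trans hts⟩

theorem exists_irreducibleOff [RegularSpace Y] {f : X → Y} {B : Set X}
    (hB : ¬ PiecewiseSmall f B)
    (hthick : ∀ V, IsOpen V → (B ∩ V).Nonempty → ¬ PiecewiseSmall f (B ∩ V)) :
    ∃ x ∈ closure B, ∃ U, IsOpen U ∧ f x ∈ U ∧ IrreducibleOff f x B U := by
  by_contra! hneg
  refine hB (piecewiseSmall_of_continuousOn_closure fun x hx => ?_)
  rw [ContinuousWithinAt, tendsto_nhds]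
  intro O hO hxO
  obtain ⟨U, hU, hxU, hUO⟩ := exists_isOpen_closure_subset hO hxO
  have h₁ := hneg x hx U hU hxU
  simp only [IrreducibleOff, not_forall, not_not] at h₁
  obtain ⟨V, hV, hxV, hVs⟩ := h₁
  refine mem_nhdsWithin.2 ⟨V, hV, hxV, ?_⟩
  rintro y ⟨hyV, hyB⟩
  by_contra hyO
  obtain ⟨U', hU', hyU', hsub⟩ :=
    exists_isOpen_closure_subset isClosed_closure.isOpen_compl
      (fun h => hyO (hUO h) : f y ∈ (closure U)ᶜ)
  have hdisj : Disjoint (closure U) (closure U') :=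
    disjoint_right.2 fun z hz => hsub hz
  have h₂ := hneg y hyB U' hU' hyU'
  simp only [IrreducibleOff, not_forall, not_not] at h₂
  obtain ⟨V', hV', hyV', hV's⟩ := h₂
  refine hthick (V ∩ V') (hV.inter hV') ?_ ((hVs.union hV's).mono ?_)
  · rw [inter_comm]
    exact mem_closure_iff.1 hyB _ (hV.inter hV') ⟨hyV, hyV'⟩
  · rintro z ⟨hzB, hz, hz'⟩
    have hzU : z ∈ Af f U ∪ Af f U' := by
      rw [Af_union_Af_of_disjoint f hdisj]
      exact mem_univ z
    rcases hzU with h | h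
    exacts [Or.inl ⟨⟨hzB, hz⟩, h⟩, Or.inr ⟨⟨hzB, hz'⟩, h⟩]

theorem exists_irreducibleOff_union [ParacompactSpace X] [RegularSpace Y]
    (hGdelta : ∀ s : Set X, IsClosed s → IsGδ s) {f : X → Y} {A : Set Y} {B : Set X}
    (hB : ¬ PiecewiseSmall f B) (hBA : closure B ⊆ Af f A) :
    ∃ x ∈ closure B, ∃ U, IsOpen U ∧ f x ∈ U ∧ Disjoint (closure A) (closure U) ∧
      IrreducibleOff f x B (A ∪ U) := by
  obtain ⟨B', hB'B, hB', hthick⟩ := exists_subset_everywhere_not_piecewiseSmall hGdelta hB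
  obtain ⟨x, hx, U, hU, hxU, hirr⟩ := exists_irreducibleOff hB' hthick
  have hxB : x ∈ closure B := closure_mono hB'B hx
  obtain ⟨U', hU', hxU', hsub⟩ := exists_isOpen_closure_subset
    (hU.inter (isClosed_closure (s := A)).isOpen_compl) ⟨hxU, hBA hxB⟩
  refine ⟨x, hxB, U', hU', hxU', disjoint_right.2 fun z hz => (hsub hz).2, ?_⟩
  intro V hV hxV hs
  refine hirr.mono hB'B (fun z hz => (hsub (subset_closure hz)).1) V hV hxV (hs.mono ?_)
  rintro z ⟨⟨hzB, hzV⟩, hzU⟩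
  rw [Af_union]
  exact ⟨⟨hzB, hzV⟩, hBA (subset_closure hzB), hzU⟩

/-- A new irreducible point can be found without destroying the irreducibility of finitely
many given ones. -/
theorem exists_irreducibleOff_union_finset [ParacompactSpace X] [RegularSpace Y]
    (hGdelta : ∀ s : Set X, IsClosed s → IsGδ s) {f : X → Y} (hf : Sigma02Measurable f)
    {ι : Type*} (x : ι → X) (S : ι → Set X) (I : Finset ι) (A : Set Y) (B : Set X)
    (hI : ∀ i ∈ I, IrreducibleOff f (x i) (S i) A)
    (hB : ¬ PiecewiseSmall f B) (hBA : closure B ⊆ Af f A) :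
    ∃ y ∈ closure B, ∃ U, IsOpen U ∧ f y ∈ U ∧ Disjoint (closure A) (closure U) ∧
      IrreducibleOff f y B (A ∪ U) ∧ ∀ i ∈ I, IrreducibleOff f (x i) (S i) (A ∪ U) := by
  classical
  induction I using Finset.strongInduction generalizing A B with
  | H I ih =>
  obtain ⟨y, hy, U, hU, hyU, hdisj, hirr⟩ := exists_irreducibleOff_union hGdelta hB hBA
  by_cases hall : ∀ i ∈ I, IrreducibleOff f (x i) (S i) (A ∪ U)
  · exact ⟨y, hy, U, hU, hyU, hdisj, hirr, hall⟩
  push Not at hall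
  obtain ⟨i₀, hi₀, hbad⟩ := hall
  obtain ⟨D, hD, hDeq⟩ := hf (closure U)ᶜ isClosed_closure.isOpen_compl
  have hBU : ¬ PiecewiseSmall f (B ∩ Af f U) := fun h =>
    hirr.mono subset_rfl subset_union_right univ isOpen_univ (mem_univ y)
      (h.mono fun z hz => ⟨hz.1.1, hz.2⟩)
  obtain ⟨n, hn⟩ := exists_not_piecewiseSmall_inter hBU
    (inter_subset_right.trans hDeq.subset)
  have hcl : closure (B ∩ Af f U ∩ D n) ⊆ closure B ∩ D n :=
    subset_inter (closure_mono (inter_subset_left.trans inter_subset_left))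
      (closure_minimal inter_subset_right (hD n))
  have hclA : closure (B ∩ Af f U ∩ D n) ⊆ Af f (A ∪ U) := by
    rw [Af_union]
    exact fun z hz => ⟨hBA (hcl hz).1, hDeq.superset (mem_iUnion.2 ⟨n, (hcl hz).2⟩)⟩
  obtain ⟨y', hy', U', hU', hyU', hdisj', hirr', hI'⟩ :=
    ih (I.filter fun i => IrreducibleOff f (x i) (S i) (A ∪ U))
      (Finset.filter_ssubset.2 ⟨i₀, hi₀, hbad⟩) (A ∪ U) (B ∩ Af f U ∩ D n)
      (fun i hi => (Finset.mem_filter.1 hi).2) hn hclA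
  rw [closure_union, disjoint_union_left] at hdisj'
  have hsub : A ∪ U' ⊆ A ∪ U ∪ U' := union_subset_union_left U' subset_union_left
  refine ⟨y', (hcl hy').1, U', hU', hyU', hdisj'.1,
    hirr'.mono (inter_subset_left.trans inter_subset_left) hsub, fun i hi => ?_⟩
  by_cases hgood : IrreducibleOff f (x i) (S i) (A ∪ U)
  · exact (hI' i (Finset.mem_filter.2 ⟨hi, hgood⟩)).mono subset_rfl hsub
  · exact ((hI i hi).union_or_union hdisj'.2).resolve_left hgood

theorem PiecewiseContinuous.isFsigma_preimage
    (hGdelta : ∀ s : Set X, IsClosed s → IsGδ s) {f : X → Y} (hf : PiecewiseContinuous f)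
    {U : Set Y} (hU : IsOpen U) : IsFsigma (f ⁻¹' U) := by
  obtain ⟨C, hC, hcover, hfC⟩ := hf
  choose O hO hOeq using fun n => continuousOn_iff'.1 (hfC n) U hU
  choose E hE hEeq using fun n => isFsigma_of_isOpen hGdelta (hO n)
  refine ⟨fun m => E m.unpair.1 m.unpair.2 ∩ C m.unpair.1, fun m => (hE _ _).inter (hC _), ?_⟩
  ext x
  rw [mem_iUnion]
  constructor
  · intro hx
    obtain ⟨n, hn⟩ := mem_iUnion.1 (hcover.superset (mem_univ x))
    have hxO : x ∈ O n := ((hOeq n).subset ⟨hx, hn⟩).1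
    obtain ⟨k, hk⟩ := mem_iUnion.1 ((hEeq n).subset hxO)
    exact ⟨Nat.pair n k, by simpa using ⟨hk, hn⟩⟩
  · rintro ⟨m, hmE, hmC⟩
    have hxO := (hEeq m.unpair.1).superset (mem_iUnion.2 ⟨_, hmE⟩)
    exact ((hOeq m.unpair.1).superset ⟨hxO, hmC⟩).1

theorem PiecewiseContinuous.isGδ_preimage {f : X → Y} (hf : PiecewiseContinuous f)
    {U : Set Y} (hU : IsOpen U) : IsGδ (f ⁻¹' U) := by
  obtain ⟨C, hC, hcover, hfC⟩ := hf
  refine isGδ_iff_eq_iInter_nat.2 ⟨fun n => (C n ∩ f ⁻¹' Uᶜ)ᶜ, fun n =>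
    ((hfC n).preimage_isClosed_of_isClosed (hC n) hU.isClosed_compl).isOpen_compl, ?_⟩
  rw [← compl_iUnion, ← iUnion_inter, hcover, univ_inter, preimage_compl, compl_compl]

end ContinuityIdeal

theorem exists_seq_of_forall_stage {α : Type*} (P : ℕ → (ℕ → α) → Prop)
    (hcongr : ∀ k g h, (∀ i ≤ k, g i = h i) → P k g → P k h) (hzero : ∃ g, P 0 g)
    (hstep : ∀ k g, P k g → ∃ a, P (k + 1) (Function.update g (k + 1) a)) :
    ∃ g, ∀ k, P k g := by
  obtain ⟨g₀, hg₀⟩ := hzero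
  choose next hnext using hstep
  let G : (k : ℕ) → {g // P k g} := fun k =>
    Nat.rec ⟨g₀, hg₀⟩ (fun k g => ⟨Function.update g.1 (k + 1) (next k g.1 g.2), hnext k g.1 g.2⟩) k
  have hG : ∀ k, ∀ i ≤ k, (G k).1 i = (G i).1 i := by
    intro k
    induction k with
    | zero =>
      intro i hi
      rw [Nat.le_zero.1 hi]
    | succ k ih =>
      intro i hi
      rcases Nat.le_succ_iff.1 hi with hi | rfl
      · rw [← ih i hi]
        exact Function.update_of_ne (by omega) _ _
      · rfl
  exact ⟨fun k => (G k).1 k, fun k => hcongr k _ _ (hG k) (G k).2⟩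

section Nodes

variable {Z Y : Type*} {X : Set Z}

/-- The points of `X` reached by the Souslin scheme `F` along a branch agreeing with `β`
below `ℓ`. -/
def souslinPart (X : Set Z) (F : List ℕ → Set Z) (β : ℕ → ℕ) (ℓ : ℕ) : Set X :=
  {x | ∃ α : ℕ → ℕ, (∀ t < ℓ, α t = β t) ∧ ∀ n, (x : Z) ∈ F ((List.range n).map α)}

theorem souslinPart_subset_iUnion (F : List ℕ → Set Z) (β : ℕ → ℕ) (ℓ : ℕ) :
    souslinPart X F β ℓ ⊆ ⋃ m, souslinPart X F (Function.update β ℓ m) (ℓ + 1) := by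
  rintro x ⟨α, hα, hx⟩
  refine mem_iUnion.2 ⟨α ℓ, α, fun t ht => ?_, hx⟩
  rcases Nat.lt_succ_iff_lt_or_eq.1 ht with ht | rfl
  · rw [Function.update_of_ne ht.ne, hα t ht]
  · rw [Function.update_self]

/-- A node of the tree of irreducible points: a point, an open neighbourhood of it in the
ambient space, a set irreducible at the point, an open set of values collected so far, and an
initial segment of a branch of the Souslin scheme. -/
structure IrreducibleNode (X : Set Z) (Y : Type*) where
  point : X
  nbhd : Set Z
  body : Set X
  target : Set Y
  code : ℕ → ℕ
  depth : ℕ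

/-- The node `b` lies strictly below the node `a` in the tree. -/
structure IrreducibleNode.Below (a b : IrreducibleNode X Y) : Prop where
  nbhd_subset : b.nbhd ⊆ a.nbhd
  body_subset : b.body ⊆ a.body
  depth_lt : a.depth < b.depth
  code_eq : ∀ t < a.depth, b.code t = a.code t

theorem IrreducibleNode.Below.trans {a b c : IrreducibleNode X Y} (hab : a.Below b)
    (hbc : b.Below c) : a.Below c where
  nbhd_subset := hbc.nbhd_subset.trans hab.nbhd_subset
  body_subset := hbc.body_subset.trans hab.body_subset
  depth_lt := hab.depth_lt.trans hbc.depth_lt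
  code_eq t ht := (hbc.code_eq t (ht.trans hab.depth_lt)).trans (hab.code_eq t ht)

end Nodes

section Tree

variable {Z Y : Type*} [TopologicalSpace Z] [TopologicalSpace Y] {X : Set Z}

theorem closure_image_souslinPart_subset {F : List ℕ → Set Z} (hF : ∀ s, IsClosed (F s))
    {α β : ℕ → ℕ} {ℓ n : ℕ} (hn : n ≤ ℓ) (hαβ : ∀ t < n, α t = β t) :
    closure ((↑) '' souslinPart X F β ℓ : Set Z) ⊆ F ((List.range n).map α) := by
  refine closure_minimal ?_ (hF _)
  rintro _ ⟨x, ⟨γ, hγ, hx⟩, rfl⟩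
  have hmap : (List.range n).map α = (List.range n).map γ :=
    List.map_congr_left fun t ht => by
      have ht := List.mem_range.1 ht
      rw [hαβ t ht, hγ t (ht.trans_le hn)]
  rw [hmap]
  exact hx n

/-- The requirements on a single node. -/
structure IrreducibleNode.Valid (f : X → Y) (F : List ℕ → Set Z)
    (a : IrreducibleNode X Y) : Prop where
  isOpen_nbhd : IsOpen a.nbhd
  point_mem : (a.point : Z) ∈ a.nbhd
  isOpen_target : IsOpen a.target
  map_point_mem : f a.point ∈ a.target
  body_subset : a.body ⊆ souslinPart X F a.code a.depth

/-- The relation between a node `a` and a node `b` constructed later. -/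
structure IrreducibleNode.Precedes (f : X → Y) (a b : IrreducibleNode X Y) : Prop where
  target_subset : a.target ⊆ b.target
  closure_body_subset : closure b.body ⊆ Af f a.target
  point_notMem : (a.point : Z) ∉ closure b.nbhd
  below_or_disjoint : a.Below b ∨ Disjoint a.nbhd b.nbhd

/-- The first `k + 1` nodes of `g` form a correct partial construction, where node `k + 1` is
placed near the point of node `k.unpair.1`, within the set prescribed by `b`. -/
structure IrreducibleStage (f : X → Y) (F : List ℕ → Set Z) (b : X → ℕ → Set X) (k : ℕ)
    (g : ℕ → IrreducibleNode X Y) : Prop where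
  valid : ∀ i ≤ k, (g i).Valid f F
  irreducible : ∀ i ≤ k, IrreducibleOff f (g i).point (g i).body (g k).target
  precedes : ∀ j ≤ k, ∀ i < j, (g i).Precedes f (g j)
  point_mem : ∀ i < k, (g (i + 1)).point ∈ b (g i.unpair.1).point i

theorem IrreducibleStage.congr {f : X → Y} {F : List ℕ → Set Z} {b : X → ℕ → Set X} {k : ℕ}
    {g h : ℕ → IrreducibleNode X Y} (hg : IrreducibleStage f F b k g)
    (hgh : ∀ i ≤ k, g i = h i) : IrreducibleStage f F b k h where
  valid i hi := hgh i hi ▸ hg.valid i hi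
  irreducible i hi := hgh i hi ▸ hgh k le_rfl ▸ hg.irreducible i hi
  precedes j hj i hi := hgh j hj ▸ hgh i (hi.le.trans hj) ▸ hg.precedes j hj i hi
  point_mem i hi := hgh (i + 1) hi ▸
    hgh i.unpair.1 ((Nat.unpair_left_le i).trans hi.le) ▸ hg.point_mem i hi

theorem exists_isOpen_notMem_closure [RegularSpace Z] {x y : X} (h : ¬ x ⤳ y) :
    ∃ W : Set Z, IsOpen W ∧ (x : Z) ∈ W ∧ (y : Z) ∉ closure W := by
  have h' : ¬ (x : Z) ⤳ y := fun hs => h (Topology.IsInducing.subtypeVal.specializes_iff.1 hs)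
  rw [← disjoint_nhds_nhds_iff_not_specializes, Filter.disjoint_iff] at h'
  obtain ⟨s, hs, t, ht, hst⟩ := h'
  refine ⟨interior s, isOpen_interior, mem_interior_iff_mem_nhds.2 hs, fun hy => ?_⟩
  obtain ⟨z, hzt, hzs⟩ := mem_closure_iff_nhds.1 hy t ht
  exact disjoint_left.1 hst (interior_subset hzs) hzt

theorem IrreducibleStage.exists_succ [RegularSpace Z] [ParacompactSpace X] [RegularSpace Y]
    (hGdelta : ∀ s : Set X, IsClosed s → IsGδ s) {f : X → Y} (hf : Sigma02Measurable f)
    {F : List ℕ → Set Z} {b : X → ℕ → Set X} (hb : ∀ x n, b x n ∈ 𝓝 x) {k : ℕ}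
    {g : ℕ → IrreducibleNode X Y} (hg : IrreducibleStage f F b k g) :
    ∃ a, IrreducibleStage f F b (k + 1) (Function.update g (k + 1) a) := by
  set p := k.unpair.1
  have hpk : p ≤ k := Nat.unpair_left_le k
  set V : Set Z := (g p).nbhd ∩ ⋂ i ∈ Finset.Ioc p k, (closure (g i).nbhd)ᶜ
  have hV : IsOpen V := (hg.valid p hpk).isOpen_nbhd.inter
    (isOpen_biInter_finset fun i _ => isClosed_closure.isOpen_compl)
  have hpV : ((g p).point : Z) ∈ V := by
    refine ⟨(hg.valid p hpk).point_mem, mem_iInter₂.2 fun i hi => ?_⟩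
    obtain ⟨h₁, h₂⟩ := Finset.mem_Ioc.1 hi
    exact (hg.precedes i h₂ p h₁).point_notMem
  obtain ⟨V', hV', hpV', hV'sub⟩ := exists_isOpen_closure_subset
    ((hV.preimage continuous_subtype_val).inter (isOpen_interior (s := b (g p).point k)))
    ⟨hpV, mem_interior_iff_mem_nhds.2 (hb _ k)⟩
  obtain ⟨D, hD, hDeq⟩ := hf (closure (g k).target)ᶜ isClosed_closure.isOpen_compl
  obtain ⟨n, hn⟩ := exists_not_piecewiseSmall_inter (hg.irreducible p hpk V' hV' hpV')
    (inter_subset_right.trans hDeq.subset)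
  obtain ⟨m, hm⟩ := exists_not_piecewiseSmall_inter hn fun x hx =>
    souslinPart_subset_iUnion F _ _ ((hg.valid p hpk).body_subset hx.1.1.1)
  set B : Set X := (g p).body ∩ V' ∩ Af f (g k).target ∩ D n ∩
    souslinPart X F (Function.update (g p).code (g p).depth m) ((g p).depth + 1)
  have hclD : closure B ⊆ D n := closure_minimal (fun x hx => hx.1.2) (hD n)
  have hDA : D n ⊆ Af f (g k).target := (subset_iUnion D n).trans hDeq.superset
  have hclV : closure B ⊆ closure V' := closure_mono fun x hx => hx.1.1.1.2
  obtain ⟨y, hy, U, hU, hyU, -, hirr, hold⟩ := exists_irreducibleOff_union_finset hGdelta hf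
    (fun i => (g i).point) (fun i => (g i).body) (Finset.range (k + 1)) (g k).target B
    (fun i hi => hg.irreducible i (Finset.mem_range_succ_iff.1 hi)) hm (hclD.trans hDA)
  have htarget : ∀ i ≤ k, (g i).target ⊆ (g k).target := by
    intro i hi
    rcases hi.lt_or_eq with hi | rfl
    exacts [(hg.precedes k le_rfl i hi).target_subset, subset_rfl]
  have hsep : ∀ i, ∃ W : Set Z, IsOpen W ∧ (y : Z) ∈ W ∧
      (i ≤ k → ((g i).point : Z) ∉ closure W) := by
    intro i
    by_cases hi : i ≤ k
    · have hns : ¬ y ⤳ (g i).point := fun hs =>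
        hDA (hs.mem_closed (hD n) (hclD hy))
          (subset_closure (htarget i hi (hg.valid i hi).map_point_mem))
      obtain ⟨W, hW, hyW, hiW⟩ := exists_isOpen_notMem_closure hns
      exact ⟨W, hW, hyW, fun _ => hiW⟩
    · exact ⟨univ, isOpen_univ, mem_univ _, fun h => absurd h hi⟩
  choose W hW hyW hWsep using hsep
  set N : Set Z := V ∩ ⋂ i ∈ Finset.range (k + 1), W i
  let a : IrreducibleNode X Y :=
    ⟨y, N, B, (g k).target ∪ U, Function.update (g p).code (g p).depth m, (g p).depth + 1⟩
  have ha : a.Valid f F :=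
    { isOpen_nbhd := hV.inter (isOpen_biInter_finset fun i _ => hW i)
      point_mem := ⟨(hV'sub (hclV hy)).1, mem_iInter₂.2 fun i _ => hyW i⟩
      isOpen_target := (hg.valid k le_rfl).isOpen_target.union hU
      map_point_mem := Or.inr hyU
      body_subset := fun x hx => hx.2 }
  have hbelow : (g p).Below a :=
    { nbhd_subset := fun z hz => hz.1.1
      body_subset := fun x hx => hx.1.1.1.1
      depth_lt := Nat.lt_succ_self _
      code_eq := fun t ht => Function.update_of_ne ht.ne _ _ }
  have hprec : ∀ i ≤ k, (g i).Precedes f a := fun i hi =>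
    { target_subset := (htarget i hi).trans subset_union_left
      closure_body_subset := hclD.trans (hDA.trans (Af_anti f (htarget i hi)))
      point_notMem := fun h => hWsep i hi (closure_mono (fun z hz =>
        mem_iInter₂.1 hz.2 i (Finset.mem_range_succ_iff.2 hi)) h)
      below_or_disjoint := by
        rcases lt_trichotomy i p with hip | rfl | hip
        · exact (hg.precedes p hpk i hip).below_or_disjoint.imp (fun h => h.trans hbelow)
            fun h => h.mono_right hbelow.nbhd_subset
        · exact Or.inl hbelow
        · exact Or.inr (disjoint_right.2 fun z hz hzi =>
            mem_iInter₂.1 hz.1.2 i (Finset.mem_Ioc.2 ⟨hip, hi⟩) (subset_closure hzi)) }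
  have hupd : ∀ i ≤ k, Function.update g (k + 1) a i = g i := fun i hi =>
    Function.update_of_ne (by omega) _ _
  have hself : Function.update g (k + 1) a (k + 1) = a := Function.update_self _ _ _
  refine ⟨a, ⟨fun i hi => ?_, fun i hi => ?_, fun j hj i hi => ?_, fun i hi => ?_⟩⟩
  · rcases Nat.le_succ_iff.1 hi with hi | rfl
    · rw [hupd i hi]
      exact hg.valid i hi
    · rw [hself]
      exact ha
  · rw [hself]
    rcases Nat.le_succ_iff.1 hi with hi | rfl
    · rw [hupd i hi]
      exact hold i (Finset.mem_range_succ_iff.2 hi)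
    · rw [hself]
      exact hirr
  · rcases Nat.le_succ_iff.1 hj with hj | rfl
    · rw [hupd j hj, hupd i (hi.le.trans hj)]
      exact hg.precedes j hj i hi
    · rw [hself, hupd i (Nat.lt_succ_iff.1 hi)]
      exact hprec i (Nat.lt_succ_iff.1 hi)
  · rw [hupd i.unpair.1 ((Nat.unpair_left_le i).trans (Nat.lt_succ_iff.1 hi))]
    rcases Nat.lt_succ_iff_lt_or_eq.1 hi with hi | rfl
    · rw [hupd (i + 1) hi]
      exact hg.point_mem i hi
    · rw [hself]
      exact interior_subset (hV'sub (hclV hy)).2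

theorem exists_irreducibleStage_zero [ParacompactSpace X] [RegularSpace Y]
    (hGdelta : ∀ s : Set X, IsClosed s → IsGδ s) {f : X → Y} (hf : Sigma02Measurable f)
    (hnot : ¬ PiecewiseSmall f univ) {F : List ℕ → Set Z}
    (hX : X = ⋃ α : ℕ → ℕ, ⋂ n : ℕ, F ((List.range n).map α)) (b : X → ℕ → Set X) :
    ∃ g, IrreducibleStage (Y := Y) f F b 0 g := by
  obtain ⟨y, -, U, hU, hyU, -, hirr, -⟩ := exists_irreducibleOff_union_finset hGdelta hf
    (fun i : Empty => i.elim) (fun i => i.elim) ∅ ∅ univ (by simp) hnot (by simp [Af])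
  have hcover : (univ : Set X) ⊆ souslinPart X F 0 0 := by
    intro x _
    obtain ⟨α, hα⟩ := mem_iUnion.1 (hX.subset x.2)
    exact ⟨α, fun t ht => absurd ht (Nat.not_lt_zero t), mem_iInter.1 hα⟩
  exact ⟨fun _ => ⟨y, univ, univ, U, 0, 0⟩,
    { valid := fun i _ => ⟨isOpen_univ, mem_univ _, hU, hyU, hcover⟩
      irreducible := fun i _ => hirr.mono subset_rfl subset_union_right
      precedes := fun j hj i hi => by omega
      point_mem := fun i hi => absurd hi (Nat.not_lt_zero i) }⟩

/-- An infinite tree of irreducible points contradicts the Δ⁰₂-measurability of `f`. -/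
theorem not_forall_irreducibleStage (hZ : CompletelyBaire Z) {f : X → Y}
    (hf : Delta02Measurable f) {F : List ℕ → Set Z} (hF : ∀ s, IsClosed (F s))
    (hX : X = ⋃ α : ℕ → ℕ, ⋂ n : ℕ, F ((List.range n).map α)) {b : X → ℕ → Set X}
    (hb : ∀ x, (𝓝 x).HasAntitoneBasis (b x)) (g : ℕ → IrreducibleNode X Y) :
    ¬ ∀ k, IrreducibleStage f F b k g := by
  intro hg
  have hvalid : ∀ i, (g i).Valid f F := fun i => (hg i).valid i le_rfl
  have hprec : ∀ i j, i < j → (g i).Precedes f (g j) := fun i j hij =>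
    (hg j).precedes j le_rfl i hij
  set Q : Set Z := range fun i => ((g i).point : Z)
  have hdense : ∀ O : Set Z, (∀ i, ((g i).point : Z) ∈ closure (O ∩ Q)) →
      Dense ((↑) ⁻¹' O : Set (closure Q)) := by
    intro O hO z
    rw [closure_subtype, Subtype.image_preimage_coe]
    refine closure_minimal ?_ isClosed_closure z.2
    rintro _ ⟨i, rfl⟩
    refine closure_mono ?_ (hO i)
    exact fun w hw => ⟨subset_closure hw.2, hw.1⟩
  obtain ⟨G, hGopen, hGeq⟩ := (hf (⋃ i, (g i).target)
    (isOpen_iUnion fun i => (hvalid i).isOpen_target)).2.eq_iInter_nat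
  choose O hO hOG using fun n => isOpen_induced_iff.1 (hGopen n)
  have hOdense : ∀ n, Dense ((↑) ⁻¹' O n : Set (closure Q)) := by
    refine fun n => hdense _ fun i => subset_closure ⟨?_, mem_range_self i⟩
    have hi : (g i).point ∈ f ⁻¹' ⋃ i, (g i).target :=
      mem_iUnion.2 ⟨i, (hvalid i).map_point_mem⟩
    rw [hGeq] at hi
    exact (hOG n).superset (mem_iInter.1 hi n)
  set R : ℕ → Set Z := fun i => ⋃ j ∈ Ioi i, (g j).nbhd
  have hRopen : ∀ i, IsOpen (R i) := fun i =>
    isOpen_biUnion fun j _ => (hvalid j).isOpen_nbhd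
  have hRdense : ∀ i, Dense ((↑) ⁻¹' R i : Set (closure Q)) := by
    refine fun i => hdense _ fun j => ?_
    have hlim : Filter.Tendsto (fun n => (g (Nat.pair j n + 1)).point) Filter.atTop
        (𝓝 (g j).point) := by
      refine (hb (g j).point).tendsto fun n => (hb (g j).point).antitone (Nat.right_le_pair j n) ?_
      have hmem := (hg (Nat.pair j n + 1)).point_mem (Nat.pair j n) (Nat.lt_succ_self _)
      rwa [Nat.unpair_pair] at hmem
    refine mem_closure_of_tendsto ((continuous_subtype_val.tendsto _).comp hlim)
      (Filter.eventually_atTop.2 ⟨i, fun n hn => ⟨?_, mem_range_self _⟩⟩)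
    refine mem_biUnion (mem_Ioi.2 ?_) (hvalid _).point_mem
    have := Nat.right_le_pair j n
    omega
  have : BaireSpace (closure Q) := hZ _ isClosed_closure
  have hne : Nonempty (closure Q) := ⟨⟨_, subset_closure (mem_range_self 0)⟩⟩
  obtain ⟨⟨z, hzQ⟩, hzO, hzR⟩ : ((⋂ n, (↑) ⁻¹' O n : Set (closure Q)) ∩
      ⋂ n, (↑) ⁻¹' R n).Nonempty := by
    refine Dense.nonempty ?_
    refine Dense.inter_of_Gδ
      (.iInter_of_isOpen fun n => (hO n).preimage continuous_subtype_val)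
      (.iInter_of_isOpen fun n => (hRopen n).preimage continuous_subtype_val)
      (dense_iInter_of_isOpen_nat (fun n => (hO n).preimage continuous_subtype_val) hOdense)
      (dense_iInter_of_isOpen_nat (fun n => (hRopen n).preimage continuous_subtype_val) hRdense)
  simp only [mem_iInter, mem_preimage] at hzO hzR
  have hbody : ∀ i, z ∈ (g i).nbhd → z ∈ closure ((↑) '' (g i).body : Set Z) := by
    intro i hi
    refine closure_minimal ?_ isClosed_closure
      ((hvalid i).isOpen_nbhd.inter_closure ⟨hi, hzQ⟩)
    rintro _ ⟨hji, j, rfl⟩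
    have hj : (g j).point ∈ closure (g j).body := ((hg j).irreducible j le_rfl).mem_closure
    have hjsub : (g j).body ⊆ (g i).body := by
      rcases lt_trichotomy i j with hij | rfl | hij
      · exact ((hprec i j hij).below_or_disjoint.resolve_right fun h =>
          disjoint_left.1 h hji (hvalid j).point_mem).body_subset
      · exact subset_rfl
      · exact absurd (subset_closure hji) (hprec j i hij).point_notMem
    exact image_closure_subset_closure_image continuous_subtype_val
      (mem_image_of_mem _ (closure_mono hjsub hj))
  obtain ⟨e, he, hez⟩ : ∃ e : ℕ → ℕ, StrictMono e ∧ ∀ n, z ∈ (g (e n)).nbhd := by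
    refine Nat.exists_strictMono_subsequence (P := fun n => z ∈ (g n).nbhd) fun N => ?_
    obtain ⟨j, hj, hzj⟩ := mem_iUnion₂.1 (hzR N)
    exact ⟨j, hj, hzj⟩
  have hbelow : ∀ m n, m < n → (g (e m)).Below (g (e n)) := fun m n hmn =>
    (hprec _ _ (he hmn)).below_or_disjoint.resolve_right fun h =>
      disjoint_left.1 h (hez m) (hez n)
  have hdepth : ∀ n, n ≤ (g (e n)).depth := fun n =>
    (strictMono_nat_of_lt_succ fun n => (hbelow n (n + 1) n.lt_succ_self).depth_lt).le_apply
  have hzX : z ∈ X := by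
    rw [hX]
    refine mem_iUnion.2 ⟨fun t => (g (e (t + 1))).code t, mem_iInter.2 fun n => ?_⟩
    refine closure_image_souslinPart_subset hF (hdepth n) (fun t ht => ?_)
      (closure_mono (image_mono (hvalid (e n)).body_subset) (hbody _ (hez n)))
    rcases (Nat.succ_le_of_lt ht).lt_or_eq with h | h
    · exact ((hbelow (t + 1) n h).code_eq t (hdepth (t + 1))).symm
    · rw [← h]
  have hmem : (⟨z, hzX⟩ : X) ∈ f ⁻¹' ⋃ i, (g i).target := by
    rw [hGeq]
    exact mem_iInter.2 fun n => (hOG n).subset (hzO n)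
  obtain ⟨i, hi⟩ := mem_iUnion.1 hmem
  have hie : i < e (i + 1) := he.le_apply
  have hcl : (⟨z, hzX⟩ : X) ∈ closure (g (e (i + 1))).body :=
    closure_subtype.2 (hbody _ (hez (i + 1)))
  exact (hprec _ _ hie).closure_body_subset hcl (subset_closure hi)

end Tree

/-- Main theorem: Y regular, X a Souslin-F set in a regular completely Baire
space Z, with X perfectly paracompact and first countable. Then f : X → Y is
Δ⁰₂-measurable iff it is piecewise continuous. -/
theorem statement2 {Z Y : Type*} [TopologicalSpace Z] [RegularSpace Z]
    [TopologicalSpace Y] [RegularSpace Y]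
    (hZ : CompletelyBaire Z) (X : Set Z) (hX : SouslinF X)
    [ParacompactSpace X] [FirstCountableTopology X]
    (hGdelta : ∀ s : Set X, IsClosed s → IsGδ s)
    (f : X → Y) :
    Delta02Measurable f ↔ PiecewiseContinuous f := by
  constructor
  · intro hf
    by_contra hnot
    obtain ⟨F, hF, hXF⟩ := hX
    choose b hb using fun x : X => (𝓝 x).exists_antitone_basis
    have hfσ : Sigma02Measurable f := fun U hU => (hf U hU).1
    obtain ⟨g, hg⟩ := exists_seq_of_forall_stage (IrreducibleStage f F b)
      (fun _ _ _ h hg => hg.congr h)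
      (exists_irreducibleStage_zero hGdelta hfσ
        (fun h => hnot (piecewiseContinuous_of_piecewiseSmall_univ h)) hXF b)
      (fun _ _ hg => hg.exists_succ hGdelta hfσ fun x n => (hb x).1.mem_of_mem trivial)
    exact not_forall_irreducibleStage hZ hf hF hXF hb g hg
  · exact fun hf U hU => ⟨hf.isFsigma_preimage hGdelta hU, hf.isGδ_preimage hU⟩
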